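/- In a real inner product space E, for all P0, P1, P2, Q0, Q1, Q2 ∈ E, if P0P1 eqv Q0Q1 and P0P2 eqv Q0Q2, then P1P2 eqv Q1Q2. -/

import Mathlib

/-- The Euclidean world function `σ_E(P,Q) = ½‖P−Q‖²`. -/
noncomputable def sigmaE {E : Type*} [NormedAddCommGroup E] [InnerProductSpace ℝ E]
    (P Q : E) : ℝ := ‖P - Q‖ ^ 2 / 2

/-- Equivalence of vectors in a real inner product space:
`(P0P1.Q0Q1) = |P0P1|·|Q0Q1|` and `|P0P1| = |Q0Q1|`. -/
noncomputable def eqvE {E : Type*} [NormedAddCommGroup E] [InnerProductSpace ℝ E]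
    (P0 P1 Q0 Q1 : E) : Prop :=
  (sigmaE P0 Q1 + sigmaE P1 Q0 - sigmaE P0 Q0 - sigmaE P1 Q1
    = ‖P1 - P0‖ * ‖Q1 - Q0‖) ∧ ‖P1 - P0‖ = ‖Q1 - Q0‖

theorem sigmaE_scalar_eq_inner {E : Type*} [NormedAddCommGroup E] [InnerProductSpace ℝ E]
    (P0 P1 Q0 Q1 : E) :
    sigmaE P0 Q1 + sigmaE P1 Q0 - sigmaE P0 Q0 - sigmaE P1 Q1
      = inner ℝ (P1 - P0) (Q1 - Q0) := by
  simp only [sigmaE, norm_sub_sq_real, inner_sub_left, inner_sub_right]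
  ring

theorem eqvE_iff_sub_eq_sub {E : Type*} [NormedAddCommGroup E] [InnerProductSpace ℝ E]
    (P0 P1 Q0 Q1 : E) : eqvE P0 P1 Q0 Q1 ↔ P1 - P0 = Q1 - Q0 := by
  rw [eqvE, sigmaE_scalar_eq_inner]
  constructor
  · rintro ⟨hinner, hnorm⟩
    have hzero : ‖(P1 - P0) - (Q1 - Q0)‖ ^ 2 = 0 := by
      rw [norm_sub_sq_real, hinner, hnorm]
      ring
    exact sub_eq_zero.mp (norm_eq_zero.mp (pow_eq_zero_iff two_ne_zero |>.mp hzero))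
  · intro h
    rw [h]
    exact ⟨real_inner_self_eq_norm_mul_norm _, rfl⟩

/-- In a real inner product space, if `P0P1 eqv Q0Q1` and
`P0P2 eqv Q0Q2`, then `P1P2 eqv Q1Q2`. -/
theorem eqvE_of_eqvE_pair {E : Type*} [NormedAddCommGroup E] [InnerProductSpace ℝ E]
    (P0 P1 P2 Q0 Q1 Q2 : E)
    (h1 : eqvE P0 P1 Q0 Q1) (h2 : eqvE P0 P2 Q0 Q2) :
    eqvE P1 P2 Q1 Q2 := by
  rw [eqvE_iff_sub_eq_sub] at *
  rw [← sub_sub_sub_cancel_right P2 P1 P0, ← sub_sub_sub_cancel_right Q2 Q1 Q0, h1, h2]
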